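/- G is self-similar: for every finite binary word v, the set {g_v : g ∈ G and g(v) = v}, where for an automorphism g fixing v the section g_v ∈ Aut(T) is defined by g(v ++ w) = v ++ g_v(w) for all words w, is exactly the subgroup G of Aut(T). -/

import Mathlib

namespace Grig

def aFun : List Bool → List Bool
  | [] => []
  | x :: v => (!x) :: v

mutual
  def bFun : List Bool → List Bool
    | [] => []
    | false :: v => false :: aFun v
    | true :: v => true :: cFun v
  def cFun : List Bool → List Bool
    | [] => []
    | false :: v => false :: aFun v
    | true :: v => true :: dFun v
  def dFun : List Bool → List Bool
    | [] => []
    | false :: v => false :: v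
    | true :: v => true :: bFun v
end

theorem aFun_invol : Function.Involutive aFun := by
  intro v; cases v <;> simp [aFun]

theorem bcd_invol : ∀ v, bFun (bFun v) = v ∧ cFun (cFun v) = v ∧ dFun (dFun v) = v := by
  intro v
  induction v with
  | nil => simp [bFun, cFun, dFun]
  | cons x v ih =>
    cases x <;> simp [bFun, cFun, dFun, aFun_invol v, ih.1, ih.2.1, ih.2.2]

/-- The automorphism `a` of the binary tree. -/
def a : Equiv.Perm (List Bool) := Function.Involutive.toPerm aFun aFun_invol

def b : Equiv.Perm (List Bool) := Function.Involutive.toPerm bFun (fun v => (bcd_invol v).1)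

def c : Equiv.Perm (List Bool) := Function.Involutive.toPerm cFun (fun v => (bcd_invol v).2.1)

def d : Equiv.Perm (List Bool) := Function.Involutive.toPerm dFun (fun v => (bcd_invol v).2.2)

/-- The Grigorchuk group, as the subgroup generated by `a, b, c, d` inside the
permutation group of the vertex set of the binary tree. -/
def grigG : Subgroup (Equiv.Perm (List Bool)) := Subgroup.closure {a, b, c, d}

end Grig

namespace Grig

theorem a_apply (w : List Bool) : a w = aFun w := rfl
theorem b_apply (w : List Bool) : b w = bFun w := rfl
theorem c_apply (w : List Bool) : c w = cFun w := rfl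
theorem d_apply (w : List Bool) : d w = dFun w := rfl

theorem a_cons (x : Bool) (w : List Bool) : a (x :: w) = (!x) :: w := by
  simp [a_apply, aFun]
theorem b_false (w : List Bool) : b (false :: w) = false :: a w := by
  simp [a_apply, b_apply, bFun]
theorem b_true (w : List Bool) : b (true :: w) = true :: c w := by
  simp [b_apply, c_apply, bFun]
theorem c_false (w : List Bool) : c (false :: w) = false :: a w := by
  simp [a_apply, c_apply, cFun]
theorem c_true (w : List Bool) : c (true :: w) = true :: d w := by
  simp [c_apply, d_apply, cFun]
theorem d_false (w : List Bool) : d (false :: w) = false :: w := by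
  simp [d_apply, dFun]
theorem d_true (w : List Bool) : d (true :: w) = true :: b w := by
  simp [b_apply, d_apply, dFun]

theorem a_mem : a ∈ grigG := Subgroup.subset_closure (by simp)
theorem b_mem : b ∈ grigG := Subgroup.subset_closure (by simp)
theorem c_mem : c ∈ grigG := Subgroup.subset_closure (by simp)
theorem d_mem : d ∈ grigG := Subgroup.subset_closure (by simp)

theorem grigG_nil {g : Equiv.Perm (List Bool)} (hg : g ∈ grigG) : g [] = [] := by
  unfold grigG at hg
  induction hg using Subgroup.closure_induction with
  | mem x hx =>
    rcases hx with rfl | rfl | rfl | rfl <;>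
      simp [a_apply, b_apply, c_apply, d_apply, aFun, bFun, cFun, dFun]
  | one => rfl
  | mul x y _ _ hx hy => simp [hx, hy]
  | inv x _ hx => rw [Equiv.Perm.inv_eq_iff_eq, hx]

/-- First-level decomposition of the elements of the group. -/
theorem grigG_decomp {g : Equiv.Perm (List Bool)} (hg : g ∈ grigG) :
    ∃ (s : Equiv.Perm Bool) (h : Bool → Equiv.Perm (List Bool)), (∀ x, h x ∈ grigG) ∧
      ∀ x w, g (x :: w) = s x :: h x w := by
  unfold grigG at hg
  induction hg using Subgroup.closure_induction with
  | mem x hx =>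
    rcases hx with rfl | rfl | rfl | rfl
    · exact ⟨Equiv.boolNot, fun _ => 1, fun _ => one_mem _, fun x w => by simp [a_cons]⟩
    · refine ⟨1, fun x => if x then c else a, fun x => ?_, fun x w => ?_⟩ <;>
        cases x <;> simp [b_false, b_true, a_mem, c_mem]
    · refine ⟨1, fun x => if x then d else a, fun x => ?_, fun x w => ?_⟩ <;>
        cases x <;> simp [c_false, c_true, a_mem, d_mem]
    · refine ⟨1, fun x => if x then b else 1, fun x => ?_, fun x w => ?_⟩ <;>
        cases x <;> simp [d_false, d_true, b_mem, one_mem]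
  | one => exact ⟨1, fun _ => 1, fun _ => one_mem _, fun x w => by simp⟩
  | mul g₁ g₂ _ _ h₁ h₂ =>
    obtain ⟨s, h, hm, hs⟩ := h₁
    obtain ⟨t, k, km, ht⟩ := h₂
    exact ⟨s * t, fun x => h (t x) * k x, fun x => mul_mem (hm _) (km _),
      fun x w => by simp [hs, ht]⟩
  | inv g _ h₁ =>
    obtain ⟨s, h, hm, hs⟩ := h₁
    refine ⟨s⁻¹, fun x => (h (s⁻¹ x))⁻¹, fun x => inv_mem (hm _), fun x w => ?_⟩
    rw [Equiv.Perm.inv_eq_iff_eq, hs]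
    simp

/-- Every element of the group is a section at a given letter. -/
theorem grigG_lift (x : Bool) {h : Equiv.Perm (List Bool)} (hh : h ∈ grigG) :
    ∃ g ∈ grigG, ∀ w, g (x :: w) = x :: h w := by
  unfold grigG at hh
  induction hh using Subgroup.closure_induction with
  | mem y hy =>
    have conj : ∀ g ∈ grigG, a * g * a ∈ grigG :=
      fun g hg => mul_mem (mul_mem a_mem hg) a_mem
    cases x
    · rcases hy with rfl | rfl | rfl | rfl
      · exact ⟨b, b_mem, b_false⟩
      · exact ⟨_, conj d d_mem, fun w => by simp [a_cons, d_true]⟩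
      · exact ⟨_, conj b b_mem, fun w => by simp [a_cons, b_true]⟩
      · exact ⟨_, conj c c_mem, fun w => by simp [a_cons, c_true]⟩
    · rcases hy with rfl | rfl | rfl | rfl
      · exact ⟨_, conj b b_mem, fun w => by simp [a_cons, b_false]⟩
      · exact ⟨d, d_mem, d_true⟩
      · exact ⟨b, b_mem, b_true⟩
      · exact ⟨c, c_mem, c_true⟩
  | one => exact ⟨1, one_mem _, fun w => by simp⟩
  | mul h₁ h₂ _ _ i₁ i₂ =>
    obtain ⟨g₁, m₁, e₁⟩ := i₁
    obtain ⟨g₂, m₂, e₂⟩ := i₂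
    exact ⟨g₁ * g₂, mul_mem m₁ m₂, fun w => by simp [e₁, e₂]⟩
  | inv h _ i =>
    obtain ⟨g, m, e⟩ := i
    refine ⟨g⁻¹, inv_mem m, fun w => ?_⟩
    rw [Equiv.Perm.inv_eq_iff_eq, e]
    simp

theorem grigG_decomp_word (v : List Bool) : ∀ g ∈ grigG,
    ∃ u : List Bool, u.length = v.length ∧ ∃ h ∈ grigG, ∀ w, g (v ++ w) = u ++ h w := by
  induction v with
  | nil => exact fun g hg => ⟨[], rfl, g, hg, fun w => rfl⟩
  | cons x v ih =>
    intro g hg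
    obtain ⟨s, h, hm, hs⟩ := grigG_decomp hg
    obtain ⟨u, hu, k, hk, e⟩ := ih (h x) (hm x)
    exact ⟨s x :: u, by simp [hu], k, hk, fun w => by simp [hs, e]⟩

theorem grigG_lift_word (v : List Bool) : ∀ h ∈ grigG,
    ∃ g ∈ grigG, ∀ w, g (v ++ w) = v ++ h w := by
  induction v with
  | nil => exact fun h hh => ⟨h, hh, fun w => rfl⟩
  | cons x v ih =>
    intro h hh
    obtain ⟨k, hk, e⟩ := ih h hh
    obtain ⟨g, hg, e'⟩ := grigG_lift x hk
    exact ⟨g, hg, fun w => by simp [e', e]⟩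

/-- The Grigorchuk group is self-similar: for every finite binary word `v`, the set of
sections `g_v` (characterized by `g (v ++ w) = v ++ g_v w`) of elements `g ∈ G` fixing
`v` is exactly `G`. -/
theorem grigG_self_similar (v : List Bool) :
    {gv : Equiv.Perm (List Bool) | ∃ g ∈ grigG, g v = v ∧
        ∀ w : List Bool, g (v ++ w) = v ++ gv w}
      = (grigG : Set (Equiv.Perm (List Bool))) := by
  ext k
  constructor
  · rintro ⟨g, hg, -, e⟩
    obtain ⟨u, hu, h, hh, e'⟩ := grigG_decomp_word v g hg
    have : k = h := by
      ext1 w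
      exact (List.append_inj ((e w).symm.trans (e' w)) hu.symm).2
    rw [this]
    exact hh
  · intro hk
    obtain ⟨g, hg, e⟩ := grigG_lift_word v k hk
    refine ⟨g, hg, ?_, e⟩
    have := e []
    rwa [grigG_nil hk, List.append_nil] at this

end Grig
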